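/- arXiv:1505.02998 — 2 statements merged into one kernel-verified Lean document; each statement's English description precedes it below -/
import Mathlib

section
/- Let γ>1, A>0, E>0, 0<r₀<r₁ and let K₀ be a constant with 0<K₀<2(γ−1)E/(γ+1). Let 𝓜={x∈ℝ³ : r₀<|x|<r₁}. Suppose φ:cl(𝓜)→ℝ is twice continuously differentiable, satisfies |∇φ(x)|²<2E for all x∈cl(𝓜), and solves the potential flow equation div(ρ(|∇φ|²)∇φ)=0 in 𝓜, where ρ(q):=((γ−1)(E−q/2)/(γA))^{1/(γ−1)}>0 (so that (1/2)|∇φ|²+γAρ^{γ−1}/(γ−1)=E), together with the boundary conditions φ(x)=0 for |x|=r₁, |∇φ(x)|²=K₀ for |x|=r₀, and ∇φ(x)·x ≥ 0 for |x|=r₀. Then φ is spherically symmetric, i.e. there exists Φ:[r₀,r₁]→ℝ with φ(x)=Φ(|x|) for all x∈cl(𝓜), and the flow is subsonic: |∇φ(x)|² < (γ−1)(E−|∇φ(x)|²/2) for all x∈cl(𝓜). -/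
open scoped BigOperators

/-- Euclidean norm on `Fin 3 → ℝ`. -/
noncomputable def enorm3 (x : Fin 3 → ℝ) : ℝ := Real.sqrt (∑ i, (x i) ^ 2)

/-- Partial derivative `∂ⱼ f` at `x` within the set `s`. -/
noncomputable def pdW (s : Set (Fin 3 → ℝ)) (j : Fin 3) (f : (Fin 3 → ℝ) → ℝ)
    (x : Fin 3 → ℝ) : ℝ :=
  fderivWithin ℝ f s x (Pi.single j 1)

open Filter Topology MeasureTheory

/-- The linear functional `v ↦ ∑ i, a i * v i`. -/
noncomputable def dotCLM (a : Fin 3 → ℝ) : (Fin 3 → ℝ) →L[ℝ] ℝ :=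
  ∑ i, a i • ContinuousLinearMap.proj (R := ℝ) (φ := fun _ : Fin 3 => ℝ) i

@[simp] lemma dotCLM_apply (a v : Fin 3 → ℝ) : dotCLM a v = ∑ i, a i * v i := by
  simp [dotCLM]

lemma clm_apply_eq_sum (L : (Fin 3 → ℝ) →L[ℝ] ℝ) (v : Fin 3 → ℝ) :
    L v = ∑ i, L (Pi.single i 1) * v i := by
  have h : v = ∑ i, v i • (Pi.single i 1 : Fin 3 → ℝ) := by
    ext j
    simp [Finset.sum_apply, Pi.single_apply]
  conv_lhs => rw [h]
  simp [mul_comm]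

lemma eq_dotCLM (L : (Fin 3 → ℝ) →L[ℝ] ℝ) : L = dotCLM fun i => L (Pi.single i 1) :=
  ContinuousLinearMap.ext fun v => by rw [clm_apply_eq_sum, dotCLM_apply]

/-- Necessary second-order condition at a local maximum. -/
lemma IsLocalMax.hasDerivAt_deriv_nonpos {f f' : ℝ → ℝ} {a c : ℝ} (hmax : IsLocalMax f a)
    (hf : ∀ᶠ t in 𝓝 a, HasDerivAt f (f' t) t) (hf' : HasDerivAt f' c a) : c ≤ 0 := by
  by_contra! hc
  have hd : deriv f =ᶠ[𝓝 a] f' := hf.mono fun t ht => ht.deriv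
  have hdd : deriv (deriv f) a = c := by rw [hd.deriv_eq, hf'.deriv]
  have hmin : IsLocalMin f a := isLocalMin_of_deriv_deriv_pos (by rw [hdd]; exact hc)
    hmax.deriv_eq_zero hf.self_of_nhds.continuousAt
  have hconst : f =ᶠ[𝓝 a] fun _ => f a := by
    filter_upwards [hmax, hmin] with t h1 h2 using le_antisymm h1 h2
  have h0 : deriv f =ᶠ[𝓝 a] fun _ => 0 := by
    filter_upwards [hconst.eventuallyEq_nhds] with t ht
    rw [ht.deriv_eq, deriv_const]
  rw [h0.deriv_eq, deriv_const] at hdd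
  exact hc.ne hdd

/-- At a local maximum the second derivative is negative semidefinite. -/
lemma IsLocalMax.sum_mul_hessian_nonpos {w : (Fin 3 → ℝ) → ℝ} {q : Fin 3 → (Fin 3 → ℝ) → ℝ}
    {Q : Fin 3 → (Fin 3 → ℝ) →L[ℝ] ℝ} {x : Fin 3 → ℝ} (hmax : IsLocalMax w x)
    (hw : ∀ᶠ y in 𝓝 x, HasFDerivAt w (dotCLM fun i => q i y) y)
    (hq : ∀ i, HasFDerivAt (q i) (Q i) x) (v : Fin 3 → ℝ) :
    ∑ i, v i * Q i v ≤ 0 := by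
  have hline : ∀ t : ℝ, HasDerivAt (fun t : ℝ => x + t • v) v t := fun t => by
    simpa using ((hasDerivAt_id t).smul_const v).const_add x
  have hx : x + (0 : ℝ) • v = x := by simp
  have hcont : Tendsto (fun t : ℝ => x + t • v) (𝓝 0) (𝓝 x) := by
    have := (hline 0).continuousAt.tendsto
    rwa [hx] at this
  have hmax' : IsLocalMax (fun t : ℝ => w (x + t • v)) 0 := by
    filter_upwards [hcont.eventually hmax] with t ht
    rwa [hx]
  refine hmax'.hasDerivAt_deriv_nonpos (f' := fun t => ∑ i, v i * q i (x + t • v)) ?_ ?_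
  · filter_upwards [hcont.eventually hw] with t ht
    have := ht.comp_hasDerivAt t (hline t)
    simpa [Function.comp_def, mul_comm] using this
  · refine HasDerivAt.fun_sum fun i _ => HasDerivAt.const_mul _ ?_
    have h := hq i
    rw [← hx] at h
    exact h.comp_hasDerivAt (0 : ℝ) (hline 0)

/-- A quadratic form which is negative semidefinite has nonpositive contraction with
`a (1 - n ⊗ n) + b (n ⊗ n)`, `a, b ≥ 0`, `n` a unit vector. -/
lemma contraction_nonpos {H : Fin 3 → Fin 3 → ℝ} (hH : ∀ v : Fin 3 → ℝ,
    ∑ i, ∑ j, v i * v j * H i j ≤ 0) {n : Fin 3 → ℝ} (hn : ∑ i, n i ^ 2 = 1) {a b : ℝ}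
    (ha : 0 ≤ a) (hb : 0 ≤ b) :
    a * (∑ i, H i i - ∑ i, ∑ j, n i * n j * H i j) + b * ∑ i, ∑ j, n i * n j * H i j ≤ 0 := by
  have h1 : ∑ k, ∑ i, ∑ j, ((Pi.single k 1 : Fin 3 → ℝ) i - n k * n i) *
      ((Pi.single k 1 : Fin 3 → ℝ) j - n k * n j) * H i j ≤ 0 :=
    Finset.sum_nonpos fun k _ => hH fun i => (Pi.single k 1 : Fin 3 → ℝ) i - n k * n i
  have h2 : ∑ k, ∑ i, ∑ j, ((Pi.single k 1 : Fin 3 → ℝ) i - n k * n i) *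
      ((Pi.single k 1 : Fin 3 → ℝ) j - n k * n j) * H i j =
      ∑ i, H i i - ∑ i, ∑ j, n i * n j * H i j := by
    simp only [Fin.sum_univ_three] at hn ⊢
    simp
    linear_combination (n 0 * n 0 * H 0 0 + n 0 * n 1 * H 0 1 + n 0 * n 2 * H 0 2 +
      n 1 * n 0 * H 1 0 + n 1 * n 1 * H 1 1 + n 1 * n 2 * H 1 2 +
      n 2 * n 0 * H 2 0 + n 2 * n 1 * H 2 1 + n 2 * n 2 * H 2 2) * hn
  rw [h2] at h1
  exact add_nonpos (mul_nonpos_of_nonneg_of_nonpos ha h1)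
    (mul_nonpos_of_nonneg_of_nonpos hb (hH n))

lemma continuous_enorm3 : Continuous enorm3 := by
  unfold enorm3
  fun_prop

lemma enorm3_nonneg (x : Fin 3 → ℝ) : 0 ≤ enorm3 x := Real.sqrt_nonneg _

lemma enorm3_sq (x : Fin 3 → ℝ) : enorm3 x ^ 2 = ∑ i, x i ^ 2 :=
  Real.sq_sqrt (Finset.sum_nonneg fun i _ => sq_nonneg (x i))

lemma hasFDerivAt_enorm3 {x : Fin 3 → ℝ} (hx : 0 < enorm3 x) :
    HasFDerivAt enorm3 (dotCLM fun i => x i / enorm3 x) x := by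
  have h1 : HasFDerivAt (fun y : Fin 3 → ℝ => ∑ i, y i ^ 2)
      (∑ i, (2 * x i) • ContinuousLinearMap.proj (R := ℝ) (φ := fun _ : Fin 3 => ℝ) i) x := by
    refine HasFDerivAt.fun_sum fun i _ => ?_
    simpa using (hasFDerivAt_apply (𝕜 := ℝ) i x).pow 2
  have hne : ∑ i, x i ^ 2 ≠ 0 := by
    rw [← enorm3_sq]; positivity
  refine (h1.sqrt hne).congr_fderiv ?_
  refine ContinuousLinearMap.ext fun v => ?_
  simp only [smul_apply, sum_apply, dotCLM_apply,
    ContinuousLinearMap.proj_apply, smul_eq_mul, Finset.mul_sum]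
  refine Finset.sum_congr rfl fun i _ => ?_
  change 1 / (2 * enorm3 x) * _ = _
  field_simp

lemma sum_mul_le_enorm3 (x y : Fin 3 → ℝ) : ∑ i, x i * y i ≤ enorm3 x * enorm3 y :=
  Real.sum_mul_le_sqrt_mul_sqrt _ x y

lemma enorm3_eq_norm (x : Fin 3 → ℝ) : enorm3 x = ‖WithLp.toLp 2 x‖ := by
  simp [EuclideanSpace.norm_eq, enorm3]

lemma abs_apply_le_enorm3 (x : Fin 3 → ℝ) (i : Fin 3) : |x i| ≤ enorm3 x := by
  rw [← Real.sqrt_sq_eq_abs]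
  exact Real.sqrt_le_sqrt (Finset.single_le_sum (f := fun i => x i ^ 2)
    (fun i _ => sq_nonneg _) (Finset.mem_univ i))

lemma isCompact_shell (r₀ r₁ : ℝ) : IsCompact {x | r₀ ≤ enorm3 x ∧ enorm3 x ≤ r₁} := by
  refine Metric.isCompact_of_isClosed_isBounded ?_ ?_
  · exact (isClosed_le continuous_const continuous_enorm3).inter
      (isClosed_le continuous_enorm3 continuous_const)
  · refine (Metric.isBounded_closedBall (x := 0) (r := |r₁|)).subset fun x hx => ?_
    rw [mem_closedBall_zero_iff, pi_norm_le_iff_of_nonneg (abs_nonneg _)]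
    exact fun i => (abs_apply_le_enorm3 x i).trans (hx.2.trans (le_abs_self _))

lemma shell_mem_nhds {r₀ r₁ : ℝ} {x : Fin 3 → ℝ} (h0 : r₀ < enorm3 x) (h1 : enorm3 x < r₁) :
    {x | r₀ ≤ enorm3 x ∧ enorm3 x ≤ r₁} ∈ 𝓝 x := by
  filter_upwards [continuous_enorm3.continuousAt.eventually (lt_mem_nhds h0),
    continuous_enorm3.continuousAt.eventually (gt_mem_nhds h1)] with y a b using ⟨a.le, b.le⟩

lemma uniqueDiffWithinAt_shell {r₀ r₁ : ℝ} {x : Fin 3 → ℝ} (hr : 0 < r₁) (h0 : r₀ < enorm3 x)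
    (h1 : enorm3 x ≤ r₁) : UniqueDiffWithinAt ℝ {x | r₀ ≤ enorm3 x ∧ enorm3 x ≤ r₁} x := by
  have hball : UniqueDiffWithinAt ℝ {x | enorm3 x ≤ r₁} x := by
    refine uniqueDiffOn_convex ?_ ?_ x h1
    · have : {x | enorm3 x ≤ r₁} = (WithLp.linearEquiv 2 ℝ (Fin 3 → ℝ)).symm ⁻¹'
          Metric.closedBall (0 : EuclideanSpace ℝ (Fin 3)) r₁ := by
        ext y
        simp [enorm3_eq_norm]
      rw [this]
      exact (convex_closedBall _ _).linear_preimage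
        (WithLp.linearEquiv 2 ℝ (Fin 3 → ℝ)).symm.toLinearMap
    · refine ⟨0, mem_interior_iff_mem_nhds.2 ?_⟩
      have : enorm3 0 < r₁ := by simpa [enorm3] using hr
      filter_upwards [continuous_enorm3.continuousAt.eventually (gt_mem_nhds this)]
        with y hy using hy.le
  have hn : {x | r₀ ≤ enorm3 x} ∈ 𝓝 x := by
    filter_upwards [continuous_enorm3.continuousAt.eventually (lt_mem_nhds h0)]
      with y hy using hy.le
  have := hball.inter hn
  rwa [Set.inter_comm] at this

lemma pdW_of_mem_nhds {s : Set (Fin 3 → ℝ)} {x : Fin 3 → ℝ} (hs : s ∈ 𝓝 x) (i : Fin 3)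
    (f : (Fin 3 → ℝ) → ℝ) : pdW s i f x = fderiv ℝ f x (Pi.single i 1) := by
  rw [pdW, fderivWithin_of_mem_nhds hs]

lemma ContDiffOn.eventually_hasFDerivAt_pdW {s : Set (Fin 3 → ℝ)} {x : Fin 3 → ℝ}
    {φ : (Fin 3 → ℝ) → ℝ} (hφ : ContDiffOn ℝ 2 φ s) (hs : s ∈ 𝓝 x) :
    ∀ᶠ y in 𝓝 x, HasFDerivAt φ (dotCLM fun i => pdW s i φ y) y := by
  filter_upwards [eventually_mem_nhds_iff.2 hs] with y hy
  have h : HasFDerivAt φ (fderiv ℝ φ y) y :=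
    ((hφ.contDiffAt hy).differentiableAt (by norm_num)).hasFDerivAt
  rw [eq_dotCLM (fderiv ℝ φ y)] at h
  simpa only [pdW_of_mem_nhds hy] using h

lemma ContDiffOn.differentiableAt_pdW {s : Set (Fin 3 → ℝ)} {x : Fin 3 → ℝ}
    {φ : (Fin 3 → ℝ) → ℝ} (hφ : ContDiffOn ℝ 2 φ s) (hs : s ∈ 𝓝 x) (i : Fin 3) :
    DifferentiableAt ℝ (pdW s i φ) x := by
  have h : DifferentiableAt ℝ (fun y => fderiv ℝ φ y (Pi.single i 1)) x :=
    (((hφ.contDiffAt hs).fderiv_right (m := 1) (by norm_num)).differentiableAt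
      (by norm_num)).clm_apply (differentiableAt_const _)
  refine h.congr_of_eventuallyEq ?_
  filter_upwards [eventually_mem_nhds_iff.2 hs] with y hy using pdW_of_mem_nhds hy i φ

/-- The divergence of `R (|p|²) p`, expanded by the product rule. -/
lemma sum_pdW_mul {s : Set (Fin 3 → ℝ)} {x : Fin 3 → ℝ} (hs : s ∈ 𝓝 x)
    {p : Fin 3 → (Fin 3 → ℝ) → ℝ} {P : Fin 3 → (Fin 3 → ℝ) →L[ℝ] ℝ}
    (hp : ∀ i, HasFDerivAt (p i) (P i) x) {R : ℝ → ℝ} {R' : ℝ}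
    (hR : HasDerivAt R R' (∑ j, p j x ^ 2)) :
    ∑ i, pdW s i (fun y => R (∑ j, p j y ^ 2) * p i y) x =
      R (∑ j, p j x ^ 2) * ∑ i, P i (Pi.single i 1) +
        2 * R' * ∑ i, ∑ j, p i x * p j x * P i (Pi.single j 1) := by
  have hq : HasFDerivAt (fun y => ∑ j, p j y ^ 2) (∑ j, (2 * p j x) • P j) x := by
    refine HasFDerivAt.fun_sum fun j _ => ?_
    simpa using (hp j).pow 2
  have h : ∀ i, pdW s i (fun y => R (∑ j, p j y ^ 2) * p i y) x =
      R (∑ j, p j x ^ 2) * P i (Pi.single i 1) +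
        p i x * (R' * ∑ j, 2 * p j x * P j (Pi.single i 1)) := fun i => by
    have hm : HasFDerivAt (fun y => R (∑ j, p j y ^ 2) * p i y) _ x :=
      (hR.comp_hasFDerivAt x hq).mul (hp i)
    rw [pdW_of_mem_nhds hs, hm.fderiv]
    simp [sum_apply]
  simp only [h]
  simp only [Fin.sum_univ_three]
  ring

lemma hasFDerivAt_radial_field {x : Fin 3 → ℝ} (hx : 0 < enorm3 x) {g : ℝ → ℝ} {g' : ℝ}
    (hg : HasDerivAt g g' (enorm3 x)) (i : Fin 3) :
    HasFDerivAt (fun y => g (enorm3 y) / enorm3 y * y i)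
      ((g (enorm3 x) / enorm3 x) • ContinuousLinearMap.proj (R := ℝ) (φ := fun _ : Fin 3 => ℝ) i +
        x i • (((g' * enorm3 x - g (enorm3 x)) / enorm3 x ^ 2) •
          dotCLM fun j => x j / enorm3 x)) x := by
  have h : HasDerivAt (fun r => g r / r) ((g' * enorm3 x - g (enorm3 x)) / enorm3 x ^ 2)
      (enorm3 x) := by
    simpa only [mul_one] using hg.fun_div (hasDerivAt_id' (enorm3 x)) hx.ne'
  exact (h.comp_hasFDerivAt x (hasFDerivAt_enorm3 hx)).mul (hasFDerivAt_apply (𝕜 := ℝ) i x)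

lemma hasFDerivAt_radial {x : Fin 3 → ℝ} (hx : 0 < enorm3 x) {Ψ : ℝ → ℝ} {c : ℝ}
    (hΨ : HasDerivAt Ψ c (enorm3 x)) :
    HasFDerivAt (fun y => Ψ (enorm3 y)) (dotCLM fun i => c / enorm3 x * x i) x := by
  refine (hΨ.comp_hasFDerivAt x (hasFDerivAt_enorm3 hx)).congr_fderiv ?_
  refine ContinuousLinearMap.ext fun v => ?_
  simp only [smul_apply, dotCLM_apply, smul_eq_mul, Finset.mul_sum]
  exact Finset.sum_congr rfl fun i _ => by ring

/-- If a radial function touches a solution `φ` of `div (R (|∇φ|²) ∇φ) = 0` at an interior point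
where its gradient is elliptic, then it satisfies a one-sided differential inequality there. -/
lemma radial_flux_nonneg_of_touching {s : Set (Fin 3 → ℝ)} {x : Fin 3 → ℝ}
    {φ : (Fin 3 → ℝ) → ℝ} (hφ : ContDiffOn ℝ 2 φ s) (hs : s ∈ 𝓝 x) {R : ℝ → ℝ} {R' : ℝ}
    (heq : ∑ i, pdW s i (fun y => R (∑ j, pdW s j φ y ^ 2) * pdW s i φ y) x = 0)
    (hx : 0 < enorm3 x) {Ψ g : ℝ → ℝ} {g' : ℝ}
    (hΨ : ∀ᶠ r in 𝓝 (enorm3 x), HasDerivAt Ψ (g r) r) (hg : HasDerivAt g g' (enorm3 x))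
    (hR : HasDerivAt R R' (g (enorm3 x) ^ 2)) (hR0 : 0 ≤ R (g (enorm3 x) ^ 2))
    (hell : 0 ≤ R (g (enorm3 x) ^ 2) + 2 * R' * g (enorm3 x) ^ 2) {σ : ℝ} (hσ : σ ≠ 0)
    (hmax : IsLocalMax (fun y => σ * (φ y - Ψ (enorm3 y))) x) :
    0 ≤ σ * ((R (g (enorm3 x) ^ 2) + 2 * R' * g (enorm3 x) ^ 2) * g' +
      2 * R (g (enorm3 x) ^ 2) * g (enorm3 x) / enorm3 x) := by
  have hpos : ∀ᶠ y in 𝓝 x, 0 < enorm3 y :=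
    continuous_enorm3.continuousAt.eventually (lt_mem_nhds hx)
  have hw : ∀ᶠ y in 𝓝 x, HasFDerivAt (fun y => σ * (φ y - Ψ (enorm3 y)))
      (dotCLM fun i => σ * (pdW s i φ y - g (enorm3 y) / enorm3 y * y i)) y := by
    filter_upwards [hφ.eventually_hasFDerivAt_pdW hs, hpos,
      continuous_enorm3.continuousAt.eventually hΨ] with y h1 h2 h3
    refine ((h1.sub (hasFDerivAt_radial h2 h3)).const_mul σ).congr_fderiv ?_
    refine ContinuousLinearMap.ext fun v => ?_
    simp [Fin.sum_univ_three]
    ring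
  have hP := fun i => (hφ.differentiableAt_pdW hs i).hasFDerivAt
  have hQ := fun i => ((hP i).sub (hasFDerivAt_radial_field hx hg i)).const_mul σ
  have hgrad : ∀ i, pdW s i φ x = g (enorm3 x) / enorm3 x * x i := fun i => by
    have h0 := hmax.hasFDerivAt_eq_zero hw.self_of_nhds
    have h1 : (dotCLM fun i => σ * (pdW s i φ x - g (enorm3 x) / enorm3 x * x i))
      (Pi.single i 1) = 0 := by rw [h0]; rfl
    have h2 : σ * (pdW s i φ x - g (enorm3 x) / enorm3 x * x i) = 0 := by
      simpa [Pi.single_apply] using h1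
    linarith [(mul_eq_zero.1 h2).resolve_left hσ]
  have hr2 := enorm3_sq x
  set r := enorm3 x
  have hnorm : ∑ j, pdW s j φ x ^ 2 = g r ^ 2 := by
    simp only [hgrad, mul_pow, ← Finset.mul_sum, ← hr2]
    field_simp
  rw [sum_pdW_mul hs hP (by rwa [hnorm]), hnorm] at heq
  have hH := hmax.sum_mul_hessian_nonpos hw hQ
  set H : Fin 3 → Fin 3 → ℝ := fun i j => fderiv ℝ (pdW s i φ) x (Pi.single j 1)
  have hn : ∑ i, (x i / r) ^ 2 = 1 := by
    simp only [div_pow, ← Finset.sum_div, ← hr2]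
    field_simp
  set n : Fin 3 → ℝ := fun i => x i / r
  have hxn : ∀ i, x i = r * n i := fun i => by simp only [n]; field_simp
  have key := contraction_nonpos (H := fun i j => σ * (H i j - (g r / r * (if i = j then 1 else 0)
      + (g' - g r / r) * (n i * n j)))) (fun v => ?_) hn hR0 hell
  · have e1 : ∑ i, ∑ j, pdW s i φ x * pdW s j φ x * H i j =
        g r ^ 2 * ∑ i, ∑ j, n i * n j * H i j := by
      simp only [hgrad, Finset.mul_sum]
      refine Finset.sum_congr rfl fun i _ => Finset.sum_congr rfl fun j _ => ?_
      rw [hxn i, hxn j]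
      field_simp
    rw [e1] at heq
    have hT : ∑ i, σ * (H i i - (g r / r * (if i = i then 1 else 0) +
        (g' - g r / r) * (n i * n i))) = σ * (∑ i, H i i - (2 * g r / r + g')) := by
      simp only [Fin.sum_univ_three] at hn ⊢
      simp only [if_true]
      linear_combination (-σ * (g' - g r / r)) * hn
    have hS : ∑ i, ∑ j, n i * n j * (σ * (H i j - (g r / r * (if i = j then 1 else 0) +
        (g' - g r / r) * (n i * n j)))) = σ * (∑ i, ∑ j, n i * n j * H i j - g') := by
      simp only [Fin.sum_univ_three] at hn ⊢
      simp
      linear_combination (-σ * (g r / r) - σ * (g' - g r / r) *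
        (n 0 ^ 2 + n 1 ^ 2 + n 2 ^ 2 + 1)) * hn
    rw [hT, hS] at key
    linear_combination key - σ * heq
  · refine le_trans (le_of_eq ?_) (hH v)
    refine Finset.sum_congr rfl fun i _ => ?_
    simp only [smul_apply, sub_apply, add_apply, dotCLM_apply, smul_eq_mul,
      ContinuousLinearMap.proj_apply]
    rw [clm_apply_eq_sum (fderiv ℝ (pdW s i φ) x) v, hxn i]
    have e2 : ∑ j, x j / r * v j = ∑ j, n j * v j := rfl
    rw [e2]
    change _ = v i * (σ * (∑ j, H i j * v j - _))
    have e4 : r * n i * ((g' * r - g r) / r ^ 2 * ∑ j, n j * v j) =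
        (g' - g r / r) * n i * ∑ j, n j * v j := by
      field_simp
    rw [e4]
    fin_cases i <;> simp [Fin.sum_univ_three] <;> ring

lemma mem_posTangentConeAt_shell {r₀ r₁ : ℝ} {x v : Fin 3 → ℝ} (h01 : r₀ < r₁)
    (hx : enorm3 x = r₀) (hv : 0 ≤ ∑ i, x i * v i) :
    v ∈ posTangentConeAt {x | r₀ ≤ enorm3 x ∧ enorm3 x ≤ r₁} x := by
  refine mem_posTangentConeAt_of_frequently_mem (Eventually.frequently ?_)
  have hc : Tendsto (fun t : ℝ => enorm3 (x + t • v)) (𝓝 0) (𝓝 r₀) := by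
    have : Continuous fun t : ℝ => enorm3 (x + t • v) :=
      continuous_enorm3.comp (by fun_prop)
    simpa [hx] using this.tendsto 0
  filter_upwards [self_mem_nhdsWithin, nhdsWithin_le_nhds (hc.eventually (gt_mem_nhds h01))]
    with t ht h1
  refine ⟨?_, h1.le⟩
  rw [← hx]
  refine Real.sqrt_le_sqrt ?_
  have ht' : 0 ≤ t := le_of_lt ht
  have e : ∑ i, (x + t • v) i ^ 2 = ∑ i, x i ^ 2 + 2 * (t * ∑ i, x i * v i) +
      t ^ 2 * ∑ i, v i ^ 2 := by
    simp [Fin.sum_univ_three]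
    ring
  rw [e]
  have h2 : 0 ≤ t * ∑ i, x i * v i := mul_nonneg ht' hv
  have h3 : 0 ≤ t ^ 2 * ∑ i, v i ^ 2 := by positivity
  linarith

/-- One-sided comparison of radial speeds at a point of the inner sphere. -/
lemma speed_comparison_of_isMaxOn {r₀ r₁ k c : ℝ} {x : Fin 3 → ℝ} {φ : (Fin 3 → ℝ) → ℝ}
    {Ψ : ℝ → ℝ} (h0 : 0 < r₀) (h01 : r₀ < r₁) (hk : 0 < k) (hx : enorm3 x = r₀)
    (hφ : DifferentiableWithinAt ℝ φ {x | r₀ ≤ enorm3 x ∧ enorm3 x ≤ r₁} x)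
    (hΨ : HasDerivAt Ψ c r₀)
    (hspeed : ∑ i, pdW {x | r₀ ≤ enorm3 x ∧ enorm3 x ≤ r₁} i φ x ^ 2 = k ^ 2)
    (hout : 0 ≤ ∑ i, pdW {x | r₀ ≤ enorm3 x ∧ enorm3 x ≤ r₁} i φ x * x i) {σ : ℝ}
    (hσ : σ = 1 ∨ σ = -1)
    (hmax : IsMaxOn (fun y => σ * (φ y - Ψ (enorm3 y)))
      {x | r₀ ≤ enorm3 x ∧ enorm3 x ≤ r₁} x) :
    σ * (k - c) ≤ 0 := by
  set s := {x | r₀ ≤ enorm3 x ∧ enorm3 x ≤ r₁}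
  set p : Fin 3 → ℝ := fun i => pdW s i φ x with hp
  rw [← hx] at hΨ
  have hd := ((hφ.hasFDerivWithinAt).sub
    (hasFDerivAt_radial (hx ▸ h0) hΨ).hasFDerivWithinAt).const_mul σ
  have key : ∀ v : Fin 3 → ℝ, 0 ≤ ∑ i, x i * v i →
      σ * (∑ i, p i * v i - c / r₀ * ∑ i, x i * v i) ≤ 0 := fun v hv => by
    have h := hmax.localize.hasFDerivWithinAt_nonpos hd (mem_posTangentConeAt_shell h01 hx hv)
    simp only [smul_apply, sub_apply, dotCLM_apply, smul_eq_mul] at h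
    rw [clm_apply_eq_sum (fderivWithin ℝ φ s x) v, hx] at h
    rw [Finset.mul_sum]
    simpa only [mul_assoc, hp, pdW] using h
  have hpn : enorm3 p = k := by
    rw [enorm3, hspeed, Real.sqrt_sq hk.le]
  have hcs : ∑ i, x i * p i ≤ r₀ * k := by
    simpa only [hx, hpn] using sum_mul_le_enorm3 x p
  have hout' : 0 ≤ ∑ i, x i * p i := by simpa only [mul_comm] using hout
  rcases hσ with rfl | rfl
  · have h := key p hout'
    simp only [← sq, one_mul] at h
    have h2 : ∑ i, p i ^ 2 = k ^ 2 := hspeed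
    rw [h2] at h
    by_contra! hc
    have h3 : c / r₀ * ∑ i, x i * p i < k ^ 2 := by
      rcases le_or_gt c 0 with hc0 | hc0
      · have : c / r₀ * ∑ i, x i * p i ≤ 0 :=
          mul_nonpos_of_nonpos_of_nonneg (div_nonpos_of_nonpos_of_nonneg hc0 h0.le) hout'
        nlinarith
      · calc c / r₀ * ∑ i, x i * p i ≤ c / r₀ * (r₀ * k) := by gcongr
          _ = c * k := by field_simp
          _ < k ^ 2 := by nlinarith
    linarith
  · have hxx : ∑ i, x i * x i = r₀ ^ 2 := by
      rw [← hx, enorm3_sq]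
      simp only [sq]
    have h := key x (hxx ▸ sq_nonneg r₀)
    have h1 : ∑ i, p i * x i = ∑ i, x i * p i := by simp only [mul_comm]
    have h2 : c / r₀ * r₀ ^ 2 = c * r₀ := by field_simp
    rw [hxx, h1, h2] at h
    have : (c - k) * r₀ ≤ 0 := by linarith
    nlinarith

/-- Comparison of a solution of `div (R (|∇φ|²) ∇φ) = 0` in a shell with a radial elliptic strict
super- or subsolution (`σ = 1` or `σ = -1`). -/
lemma comparison_radial {r₀ r₁ k : ℝ} {φ : (Fin 3 → ℝ) → ℝ} {Ψ g g' R R' : ℝ → ℝ}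
    (h0 : 0 < r₀) (h01 : r₀ < r₁) (hk : 0 < k)
    (hφ : ContDiffOn ℝ 2 φ {x | r₀ ≤ enorm3 x ∧ enorm3 x ≤ r₁})
    (heq : ∀ x, r₀ < enorm3 x → enorm3 x < r₁ →
      ∑ i, pdW {x | r₀ ≤ enorm3 x ∧ enorm3 x ≤ r₁} i (fun y =>
        R (∑ j, pdW {x | r₀ ≤ enorm3 x ∧ enorm3 x ≤ r₁} j φ y ^ 2) *
          pdW {x | r₀ ≤ enorm3 x ∧ enorm3 x ≤ r₁} i φ y) x = 0)
    (hbc1 : ∀ x, enorm3 x = r₁ → φ x = 0)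
    (hbc0 : ∀ x, enorm3 x = r₀ →
      ∑ i, pdW {x | r₀ ≤ enorm3 x ∧ enorm3 x ≤ r₁} i φ x ^ 2 = k ^ 2 ∧
      0 ≤ ∑ i, pdW {x | r₀ ≤ enorm3 x ∧ enorm3 x ≤ r₁} i φ x * x i)
    (hΨ : ∀ r ∈ Set.Icc r₀ r₁, HasDerivAt Ψ (g r) r) (hΨ1 : Ψ r₁ = 0)
    (hg : ∀ r ∈ Set.Icc r₀ r₁, HasDerivAt g (g' r) r)
    (hR : ∀ r ∈ Set.Icc r₀ r₁, HasDerivAt R (R' (g r ^ 2)) (g r ^ 2))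
    (hR0 : ∀ r ∈ Set.Icc r₀ r₁, 0 ≤ R (g r ^ 2))
    (hell : ∀ r ∈ Set.Icc r₀ r₁, 0 ≤ R (g r ^ 2) + 2 * R' (g r ^ 2) * g r ^ 2)
    {σ : ℝ} (hσ : σ = 1 ∨ σ = -1)
    (hstrict : ∀ r ∈ Set.Icc r₀ r₁, σ * ((R (g r ^ 2) + 2 * R' (g r ^ 2) * g r ^ 2) * g' r +
      2 * R (g r ^ 2) * g r / r) < 0)
    (hinner : 0 < σ * (k - g r₀)) {x : Fin 3 → ℝ} (hx0 : r₀ ≤ enorm3 x) (hx1 : enorm3 x ≤ r₁) :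
    σ * (φ x - Ψ (enorm3 x)) ≤ 0 := by
  set s := {x | r₀ ≤ enorm3 x ∧ enorm3 x ≤ r₁}
  have hcont : ContinuousOn (fun y => σ * (φ y - Ψ (enorm3 y))) s := by
    refine continuousOn_const.mul (hφ.continuousOn.sub ?_)
    exact ContinuousOn.comp (t := Set.Icc r₀ r₁)
      (fun r hr => (hΨ r hr).continuousAt.continuousWithinAt)
      continuous_enorm3.continuousOn fun y hy => hy
  obtain ⟨z, hz, hmax⟩ := (isCompact_shell r₀ r₁).exists_isMaxOn ⟨x, hx0, hx1⟩ hcont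
  refine (hmax (show x ∈ s from ⟨hx0, hx1⟩)).trans ?_
  rcases hz.2.eq_or_lt with h1 | h1
  · simp [h1, hbc1 z h1, hΨ1]
  · exfalso
    rcases hz.1.eq_or_lt with h2 | h2
    · have hb := hbc0 z h2.symm
      refine (speed_comparison_of_isMaxOn h0 h01 hk h2.symm
        (hφ.differentiableOn (by norm_num) z hz) (hΨ r₀ ⟨le_rfl, h01.le⟩) hb.1 hb.2 hσ
        hmax).not_gt hinner
    · have hs : s ∈ 𝓝 z := shell_mem_nhds h2 h1
      refine (radial_flux_nonneg_of_touching hφ hs (heq z h2 h1) (h0.trans h2) ?_ (hg _ hz)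
        (hR _ hz) (hR0 _ hz) (hell _ hz) ?_ (hmax.isLocalMax hs)).not_gt (hstrict _ hz)
      · filter_upwards [Icc_mem_nhds h2 h1] with r hr using hΨ r hr
      · rcases hσ with rfl | rfl <;> norm_num

/-- The increasing inverse of a function with positive derivative. -/
lemma exists_hasDerivAt_inverse {J J' : ℝ → ℝ} {a b : ℝ} (hab : a ≤ b)
    (hJ : ∀ t ∈ Set.Icc a b, HasDerivAt J (J' t) t) (hpos : ∀ t ∈ Set.Icc a b, 0 < J' t) :
    StrictMonoOn J (Set.Icc a b) ∧ ∃ I : ℝ → ℝ, ∀ m ∈ Set.Ioo (J a) (J b),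
      I m ∈ Set.Ioo a b ∧ J (I m) = m ∧ HasDerivAt I (J' (I m))⁻¹ m := by
  have hc : ContinuousOn J (Set.Icc a b) := fun t ht =>
    (hJ t ht).continuousAt.continuousWithinAt
  have hmono : StrictMonoOn J (Set.Icc a b) := by
    refine strictMonoOn_of_deriv_pos (convex_Icc a b) hc fun t ht => ?_
    have ht' := interior_subset ht
    rw [(hJ t ht').deriv]
    exact hpos t ht'
  refine ⟨hmono, ?_⟩
  have hex : ∀ m ∈ Set.Ioo (J a) (J b), ∃ t ∈ Set.Ioo a b, J t = m :=
    fun m hm => intermediate_value_Ioo hab hc hm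
  choose! I hI hJI using hex
  refine ⟨I, fun m hm => ⟨hI m hm, hJI m hm, ?_⟩⟩
  have hIc := fun m hm => Set.Ioo_subset_Icc_self (hI m hm)
  have hnhds : Set.Ioo (J a) (J b) ∈ 𝓝 m := Ioo_mem_nhds hm.1 hm.2
  have hImono : StrictMonoOn I (Set.Ioo (J a) (J b)) := fun x hx y hy hxy => by
    rwa [← hmono.lt_iff_lt (hIc x hx) (hIc y hy), hJI x hx, hJI y hy]
  have himage : Set.Ioo a b ⊆ I '' Set.Ioo (J a) (J b) := fun t ht => by
    have ht' := Set.Ioo_subset_Icc_self ht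
    have hm' : J t ∈ Set.Ioo (J a) (J b) :=
      ⟨hmono (Set.left_mem_Icc.2 hab) ht' ht.1, hmono ht' (Set.right_mem_Icc.2 hab) ht.2⟩
    exact ⟨J t, hm', hmono.injOn (hIc _ hm') ht' (hJI _ hm')⟩
  refine HasDerivAt.of_local_left_inverse ?_ (hJ _ (hIc m hm)) (hpos _ (hIc m hm)).ne' ?_
  · exact hImono.continuousAt_of_image_mem_nhds hnhds
      (mem_of_superset (Ioo_mem_nhds (hI m hm).1 (hI m hm).2) himage)
  · filter_upwards [hnhds] with y hy using hJI y hy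

lemma hasDerivAt_integral_of_eventually_continuousAt {g : ℝ → ℝ} {a b : ℝ}
    (hg : ∀ r ∈ Set.Icc a b, ∀ᶠ t in 𝓝 r, ContinuousAt g t) {r : ℝ} (hr : r ∈ Set.Icc a b) :
    HasDerivAt (fun u => ∫ t in b..u, g t) (g r) r := by
  refine intervalIntegral.integral_hasDerivAt_right ?_ ?_ (hg r hr).self_of_nhds
  · refine ContinuousOn.intervalIntegrable fun t ht => ?_
    rw [Set.uIcc_of_ge hr.2] at ht
    exact (hg t ⟨hr.1.trans ht.1, ht.2⟩).self_of_nhds.continuousWithinAt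
  · exact ContinuousAt.stronglyMeasurableAtFilter (isOpen_setOfPred_eventually_nhds
      (p := fun t => ContinuousAt g t)) (fun t ht => ht.self_of_nhds) r (hg r hr)

lemma exists_perturbed_flux_mem_Ioo {r₀ r₁ u U : ℝ} (h0 : 0 < r₀) (h01 : r₀ < r₁) (hu : 0 < u)
    (huU : u < U) : ∃ δ₀ > 0, ∀ δ, |δ| < δ₀ → ∀ r ∈ Set.Icc r₀ r₁,
      u * r₀ ^ 2 * (1 + δ * (1 + r - r₀)) / r ^ 2 ∈ Set.Ioo 0 U := by
  have hC : 0 < 1 + r₁ - r₀ := by linarith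
  have hU : 0 < U / u - 1 := by rw [sub_pos, one_lt_div hu]; exact huU
  refine ⟨min 1 (U / u - 1) / (1 + r₁ - r₀), by positivity, fun δ hδ r hr => ?_⟩
  rw [lt_div_iff₀ hC] at hδ
  have hr0 : 0 < r := h0.trans_le hr.1
  have h1 : |δ * (1 + r - r₀)| < min 1 (U / u - 1) := by
    rw [abs_mul, abs_of_pos (show 0 < 1 + r - r₀ by linarith [hr.1])]
    refine lt_of_le_of_lt ?_ hδ
    gcongr
    exact hr.2
  obtain ⟨h2, h3⟩ := lt_min_iff.1 h1
  have h4 := (abs_lt.1 h2).1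
  have h5 := (abs_lt.1 h3).2
  have hpos : 0 < 1 + δ * (1 + r - r₀) := by linarith
  refine ⟨by positivity, ?_⟩
  have h6 : 1 + δ * (1 + r - r₀) < U / u := by linarith
  rw [lt_div_iff₀ hu] at h6
  rw [div_lt_iff₀ (by positivity)]
  have h7 : r₀ ^ 2 ≤ r ^ 2 := by gcongr; exact hr.1
  calc u * r₀ ^ 2 * (1 + δ * (1 + r - r₀)) = ((1 + δ * (1 + r - r₀)) * u) * r₀ ^ 2 := by ring
    _ < U * r₀ ^ 2 := by gcongr
    _ ≤ U * r ^ 2 := by gcongr; exact (hu.trans huU).le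

/-- A solution of `div (R (|∇φ|²) ∇φ) = 0` in a shell, with elliptic speed on the inner sphere and
vanishing on the outer one, is radial with elliptic speed. -/
lemma exists_eq_radial {r₀ r₁ k b : ℝ} {φ : (Fin 3 → ℝ) → ℝ} {R R' : ℝ → ℝ}
    (h0 : 0 < r₀) (h01 : r₀ < r₁) (hk : 0 < k) (hkb : k < b)
    (hφ : ContDiffOn ℝ 2 φ {x | r₀ ≤ enorm3 x ∧ enorm3 x ≤ r₁})
    (heq : ∀ x, r₀ < enorm3 x → enorm3 x < r₁ →
      ∑ i, pdW {x | r₀ ≤ enorm3 x ∧ enorm3 x ≤ r₁} i (fun y =>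
        R (∑ j, pdW {x | r₀ ≤ enorm3 x ∧ enorm3 x ≤ r₁} j φ y ^ 2) *
          pdW {x | r₀ ≤ enorm3 x ∧ enorm3 x ≤ r₁} i φ y) x = 0)
    (hbc1 : ∀ x, enorm3 x = r₁ → φ x = 0)
    (hbc0 : ∀ x, enorm3 x = r₀ →
      ∑ i, pdW {x | r₀ ≤ enorm3 x ∧ enorm3 x ≤ r₁} i φ x ^ 2 = k ^ 2 ∧
      0 ≤ ∑ i, pdW {x | r₀ ≤ enorm3 x ∧ enorm3 x ≤ r₁} i φ x * x i)
    (hR : ∀ t ∈ Set.Icc 0 b, HasDerivAt R (R' (t ^ 2)) (t ^ 2))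
    (hR0 : ∀ t ∈ Set.Icc 0 b, 0 < R (t ^ 2))
    (hell : ∀ t ∈ Set.Icc 0 b, 0 < R (t ^ 2) + 2 * R' (t ^ 2) * t ^ 2) :
    ∃ Ψ g : ℝ → ℝ, (∀ r ∈ Set.Icc r₀ r₁, HasDerivAt Ψ (g r) r ∧ g r ∈ Set.Icc 0 b) ∧
      ∀ x, r₀ ≤ enorm3 x → enorm3 x ≤ r₁ → φ x = Ψ (enorm3 x) := by
  have hb : 0 < b := hk.trans hkb
  set J : ℝ → ℝ := fun t => R (t ^ 2) * t
  set J' : ℝ → ℝ := fun t => R (t ^ 2) + 2 * R' (t ^ 2) * t ^ 2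
  have hJ : ∀ t ∈ Set.Icc 0 b, HasDerivAt J (J' t) t := fun t ht => by
    have hsq : HasDerivAt (fun t : ℝ => t ^ 2) _ t := hasDerivAt_pow 2 t
    have h := (HasDerivAt.comp (h := fun t : ℝ => t ^ 2) t (hR t ht) hsq).fun_mul
      (hasDerivAt_id' t)
    refine h.congr_deriv ?_
    simp only [J', Function.comp_apply]
    push_cast
    ring
  obtain ⟨hmono, I, hI⟩ := exists_hasDerivAt_inverse hb.le hJ hell
  have hJ0 : J 0 = 0 := by simp [J]
  rw [hJ0] at hI
  have hkm : k ∈ Set.Icc 0 b := ⟨hk.le, hkb.le⟩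
  have hJk : 0 < J k := mul_pos (hR0 k hkm) hk
  obtain ⟨δ₀, hδ₀, hm⟩ := exists_perturbed_flux_mem_Ioo h0 h01 hJk
    (hmono hkm (Set.right_mem_Icc.2 hb.le) hkb)
  set m : ℝ → ℝ → ℝ := fun δ r => J k * r₀ ^ 2 * (1 + δ * (1 + r - r₀)) / r ^ 2 with hmdef
  have hm' : ∀ δ, |δ| < δ₀ → ∀ r ∈ Set.Icc r₀ r₁, m δ r ∈ Set.Ioo 0 (J b) := hm
  have hmderiv : ∀ δ r, 0 < r →
      HasDerivAt (m δ) (J k * r₀ ^ 2 * δ / r ^ 2 - 2 * m δ r / r) r := fun δ r hr => by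
    have h1 : HasDerivAt (fun r => J k * r₀ ^ 2 * (1 + δ * (1 + r - r₀)))
        (J k * r₀ ^ 2 * δ) r := by
      simpa using ((((hasDerivAt_id r).const_add 1).sub_const r₀).const_mul δ).const_add 1
        |>.const_mul (J k * r₀ ^ 2)
    refine (h1.fun_div (hasDerivAt_pow 2 r) (by positivity)).congr_deriv ?_
    simp only [hmdef]
    field_simp
    push_cast
    ring
  set g : ℝ → ℝ → ℝ := fun δ r => I (m δ r)
  set Ψ : ℝ → ℝ → ℝ := fun δ u => ∫ t in r₁..u, g δ t
  have hgderiv : ∀ δ r, 0 < r → m δ r ∈ Set.Ioo 0 (J b) → HasDerivAt (g δ)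
      ((J' (g δ r))⁻¹ * (J k * r₀ ^ 2 * δ / r ^ 2 - 2 * m δ r / r)) r :=
    fun δ r hr h => (hI _ h).2.2.comp r (hmderiv δ r hr)
  have hgcont : ∀ δ, |δ| < δ₀ → ∀ r ∈ Set.Icc r₀ r₁, ∀ᶠ t in 𝓝 r, ContinuousAt (g δ) t :=
    fun δ hδ r hr => by
      have hr0 := h0.trans_le hr.1
      filter_upwards [lt_mem_nhds hr0, (hmderiv δ r hr0).continuousAt.eventually
        (isOpen_Ioo.mem_nhds (hm' δ hδ r hr))] with t h1 h2 using (hgderiv δ t h1 h2).continuousAt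
  have hΨ : ∀ δ, |δ| < δ₀ → ∀ r ∈ Set.Icc r₀ r₁, HasDerivAt (Ψ δ) (g δ r) r :=
    fun δ hδ r hr => hasDerivAt_integral_of_eventually_continuousAt (hgcont δ hδ) hr
  have hgmem : ∀ δ, |δ| < δ₀ → ∀ r ∈ Set.Icc r₀ r₁, g δ r ∈ Set.Icc 0 b :=
    fun δ hδ r hr => Set.Ioo_subset_Icc_self (hI _ (hm' δ hδ r hr)).1
  have hcomp : ∀ σ : ℝ, σ = 1 ∨ σ = -1 → ∀ δ, |δ| < δ₀ → σ * δ < 0 → ∀ x, r₀ ≤ enorm3 x →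
      enorm3 x ≤ r₁ → σ * (φ x - Ψ δ (enorm3 x)) ≤ 0 := fun σ hσ δ hδ hσδ x hx0 hx1 => by
    refine comparison_radial h0 h01 hk hφ heq hbc1 hbc0 (hΨ δ hδ) (by simp [Ψ])
      (fun r hr => hgderiv δ r (h0.trans_le hr.1) (hm' δ hδ r hr))
      (fun r hr => hR _ (hgmem δ hδ r hr)) (fun r hr => (hR0 _ (hgmem δ hδ r hr)).le)
      (fun r hr => (hell _ (hgmem δ hδ r hr)).le) hσ (fun r hr => ?_) ?_ hx0 hx1
    · have hr0 := h0.trans_le hr.1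
      have hJ'pos : 0 < J' (g δ r) := hell _ (hgmem δ hδ r hr)
      have h1 : R (g δ r ^ 2) * g δ r = m δ r := (hI _ (hm' δ hδ r hr)).2.1
      have h2 : σ * (J' (g δ r) * ((J' (g δ r))⁻¹ * (J k * r₀ ^ 2 * δ / r ^ 2 - 2 * m δ r / r)) +
          2 * R (g δ r ^ 2) * g δ r / r) = σ * δ * (J k * r₀ ^ 2 / r ^ 2) := by
        rw [mul_inv_cancel_left₀ hJ'pos.ne', mul_assoc 2, h1]
        ring
      exact h2.trans_lt (mul_neg_of_neg_of_pos hσδ (by positivity))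
    · have hl : r₀ ∈ Set.Icc r₀ r₁ := ⟨le_rfl, h01.le⟩
      have h1 : J (g δ r₀) = J k + J k * δ := by
        rw [show J (g δ r₀) = m δ r₀ from (hI _ (hm' δ hδ r₀ hl)).2.1]
        simp only [hmdef]
        field_simp
        ring
      rcases hσ with rfl | rfl
      · have : J (g δ r₀) < J k := by rw [h1]; nlinarith
        linarith [(hmono.lt_iff_lt (hgmem δ hδ r₀ hl) hkm).1 this]
      · have : J k < J (g δ r₀) := by rw [h1]; nlinarith
        linarith [(hmono.lt_iff_lt hkm (hgmem δ hδ r₀ hl)).1 this]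
  have hz : |(0 : ℝ)| < δ₀ := by simpa using hδ₀
  have hsmall : ∀ᶠ δ : ℝ in 𝓝 0, |δ| < δ₀ :=
    (continuous_abs.tendsto 0).eventually (gt_mem_nhds hz)
  have hlim : ∀ r ∈ Set.Icc r₀ r₁, Tendsto (fun δ => Ψ δ r) (𝓝 0) (𝓝 (Ψ 0 r)) :=
    fun r hr => by
      have hsub : Set.uIoc r₁ r ⊆ Set.Icc r₀ r₁ := fun t ht => by
        rw [Set.uIoc_of_ge hr.2] at ht
        exact ⟨hr.1.trans ht.1.le, ht.2⟩
      refine intervalIntegral.tendsto_integral_filter_of_dominated_convergence (fun _ => b)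
        ?_ ?_ intervalIntegrable_const (ae_of_all _ fun t ht => ?_)
      · filter_upwards [hsmall] with δ hδ
        exact ContinuousOn.aestronglyMeasurable (fun t ht =>
          (hgcont δ hδ t (hsub ht)).self_of_nhds.continuousWithinAt) measurableSet_uIoc
      · filter_upwards [hsmall] with δ hδ
        refine ae_of_all _ fun t ht => ?_
        have h := hgmem δ hδ t (hsub ht)
        rw [Real.norm_of_nonneg h.1]
        exact h.2
      · have h1 : Tendsto (fun δ => m δ t) (𝓝 0) (𝓝 (m 0 t)) := by
          have : Continuous fun δ => m δ t := by
            simp only [hmdef]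
            fun_prop
          exact this.tendsto 0
        exact (hI _ (hm' 0 hz t (hsub ht))).2.2.continuousAt.tendsto.comp h1
  refine ⟨Ψ 0, g 0, fun r hr => ⟨hΨ 0 hz r hr, hgmem 0 hz r hr⟩, fun x hx0 hx1 => ?_⟩
  have hl := hlim _ ⟨hx0, hx1⟩
  refine le_antisymm ?_ ?_
  · refine ge_of_tendsto (hl.mono_left (nhdsWithin_le_nhds (s := Set.Iio 0))) ?_
    filter_upwards [self_mem_nhdsWithin, nhdsWithin_le_nhds hsmall] with δ h1 h2
    linarith [hcomp 1 (Or.inl rfl) δ h2 (by simpa using h1) x hx0 hx1]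
  · refine le_of_tendsto (hl.mono_left (nhdsWithin_le_nhds (s := Set.Ioi 0))) ?_
    filter_upwards [self_mem_nhdsWithin, nhdsWithin_le_nhds hsmall] with δ h1 h2
    linarith [hcomp (-1) (Or.inr rfl) δ h2 (by simpa using h1) x hx0 hx1]

/-- The gradient, up to the outer sphere, of a radial function on a shell. -/
lemma sum_sq_pdW_radial {r₀ r₁ c : ℝ} {φ : (Fin 3 → ℝ) → ℝ} {Ψ : ℝ → ℝ} (h0 : 0 < r₀)
    (hφ : ∀ x, r₀ ≤ enorm3 x → enorm3 x ≤ r₁ → φ x = Ψ (enorm3 x)) {x : Fin 3 → ℝ}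
    (hx0 : r₀ < enorm3 x) (hx1 : enorm3 x ≤ r₁) (hΨ : HasDerivAt Ψ c (enorm3 x)) :
    ∑ i, pdW {x | r₀ ≤ enorm3 x ∧ enorm3 x ≤ r₁} i φ x ^ 2 = c ^ 2 := by
  have hpos := h0.trans hx0
  have h := ((hasFDerivAt_radial hpos hΨ).hasFDerivWithinAt
    (s := {x | r₀ ≤ enorm3 x ∧ enorm3 x ≤ r₁})).congr (fun y hy => hφ y hy.1 hy.2)
    (hφ x hx0.le hx1)
  have hp : ∀ i, pdW {x | r₀ ≤ enorm3 x ∧ enorm3 x ≤ r₁} i φ x = c / enorm3 x * x i := fun i => by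
    rw [pdW, h.fderivWithin (uniqueDiffWithinAt_shell (hpos.trans_le hx1) hx0 hx1)]
    simp [Pi.single_apply]
  simp only [hp, mul_pow, ← Finset.mul_sum, ← enorm3_sq]
  field_simp

/-- The density given by Bernoulli's law as a function of the squared speed. -/
noncomputable def gasDensity (γ A E q : ℝ) : ℝ :=
  ((γ - 1) * (E - q / 2) / (γ * A)) ^ (1 / (γ - 1) : ℝ)

/-- The derivative of `gasDensity` with respect to the squared speed. -/
noncomputable def gasDensityDeriv (γ A E q : ℝ) : ℝ :=
  -(1 / (2 * (γ * A))) * ((γ - 1) * (E - q / 2) / (γ * A)) ^ (1 / (γ - 1) - 1 : ℝ)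

section gasDensity

variable {γ A E q : ℝ}

lemma gasDensity_base_pos (hγ : 1 < γ) (hA : 0 < A) (hq : q < 2 * E) :
    0 < (γ - 1) * (E - q / 2) / (γ * A) := by
  have h1 : 0 < γ - 1 := by linarith
  have h2 : 0 < E - q / 2 := by linarith
  positivity

lemma gasDensity_pos (hγ : 1 < γ) (hA : 0 < A) (hq : q < 2 * E) : 0 < gasDensity γ A E q :=
  Real.rpow_pos_of_pos (gasDensity_base_pos hγ hA hq) _

lemma hasDerivAt_gasDensity (hγ : 1 < γ) (hA : 0 < A) (hq : q < 2 * E) :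
    HasDerivAt (gasDensity γ A E) (gasDensityDeriv γ A E q) q := by
  have h1 : γ - 1 ≠ 0 := by linarith
  have h2 : γ ≠ 0 := by linarith
  have hB : HasDerivAt (fun q => (γ - 1) * (E - q / 2) / (γ * A))
      ((γ - 1) * -(1 / 2) / (γ * A)) q :=
    ((((hasDerivAt_id' q).div_const 2).const_sub E).const_mul (γ - 1)).div_const (γ * A)
  refine (hB.rpow_const (p := 1 / (γ - 1))
    (Or.inl (gasDensity_base_pos hγ hA hq).ne')).congr_deriv ?_
  rw [gasDensityDeriv]
  field_simp

lemma gasDensity_add_deriv_pos (hγ : 1 < γ) (hA : 0 < A)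
    (hq : q < 2 * (γ - 1) * E / (γ + 1)) (hqE : q < 2 * E) :
    0 < gasDensity γ A E q + 2 * gasDensityDeriv γ A E q * q := by
  have hB := gasDensity_base_pos hγ hA hqE
  have h1 : 0 < γ * A := by positivity
  rw [lt_div_iff₀ (by linarith)] at hq
  have h2 : gasDensity γ A E q = (γ - 1) * (E - q / 2) / (γ * A) *
      ((γ - 1) * (E - q / 2) / (γ * A)) ^ (1 / (γ - 1) - 1 : ℝ) := by
    rw [gasDensity, Real.rpow_sub_one hB.ne', mul_div_cancel₀ _ hB.ne']
  rw [h2, gasDensityDeriv]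
  have h3 : 0 < ((γ - 1) * E - (γ + 1) / 2 * q) / (γ * A) *
      ((γ - 1) * (E - q / 2) / (γ * A)) ^ (1 / (γ - 1) - 1 : ℝ) :=
    mul_pos (div_pos (by linarith) h1) (Real.rpow_pos_of_pos hB _)
  refine h3.trans_eq ?_
  field_simp
  ring

end gasDensity

/-- Uniqueness of spherically symmetric subsonic potential flow (Lemma 3.3):
a `C²` solution of the potential flow equation in the spherical shell, vanishing on the
outer sphere, with prescribed speed and non-negative radial derivative on the inner
sphere, is spherically symmetric and subsonic. -/
theorem potential_flow_symmetry
    (γ A E r₀ r₁ K₀ : ℝ)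
    (hγ : 1 < γ) (hA : 0 < A) (hE : 0 < E) (h0 : 0 < r₀) (h01 : r₀ < r₁)
    (hK0 : 0 < K₀) (hK1 : K₀ < 2 * (γ - 1) * E / (γ + 1))
    (φ : (Fin 3 → ℝ) → ℝ)
    (hreg : ContDiffOn ℝ 2 φ {x | r₀ ≤ enorm3 x ∧ enorm3 x ≤ r₁})
    (hspeed : ∀ x ∈ {x : Fin 3 → ℝ | r₀ ≤ enorm3 x ∧ enorm3 x ≤ r₁},
      (∑ i, (pdW {y | r₀ ≤ enorm3 y ∧ enorm3 y ≤ r₁} i φ x) ^ 2) < 2 * E)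
    (heq : ∀ x ∈ {x : Fin 3 → ℝ | r₀ < enorm3 x ∧ enorm3 x < r₁},
      (∑ i, pdW {y | r₀ ≤ enorm3 y ∧ enorm3 y ≤ r₁} i
        (fun y =>
          ((γ - 1) * (E - (∑ j, (pdW {z | r₀ ≤ enorm3 z ∧ enorm3 z ≤ r₁} j φ y) ^ 2) / 2)
              / (γ * A)) ^ (1 / (γ - 1) : ℝ)
            * pdW {z | r₀ ≤ enorm3 z ∧ enorm3 z ≤ r₁} i φ y) x) = 0)
    (hbc1 : ∀ x, enorm3 x = r₁ → φ x = 0)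
    (hbc0 : ∀ x, enorm3 x = r₀ →
      (∑ i, (pdW {y | r₀ ≤ enorm3 y ∧ enorm3 y ≤ r₁} i φ x) ^ 2) = K₀ ∧
      0 ≤ ∑ i, pdW {y | r₀ ≤ enorm3 y ∧ enorm3 y ≤ r₁} i φ x * x i) :
    (∃ Φ : ℝ → ℝ, ∀ x ∈ {x : Fin 3 → ℝ | r₀ ≤ enorm3 x ∧ enorm3 x ≤ r₁},
      φ x = Φ (enorm3 x)) ∧
    (∀ x ∈ {x : Fin 3 → ℝ | r₀ ≤ enorm3 x ∧ enorm3 x ≤ r₁},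
      (∑ i, (pdW {y | r₀ ≤ enorm3 y ∧ enorm3 y ≤ r₁} i φ x) ^ 2)
        < (γ - 1) * (E - (∑ i, (pdW {y | r₀ ≤ enorm3 y ∧ enorm3 y ≤ r₁} i φ x) ^ 2) / 2)) := by
  have hγ1 : 0 < γ + 1 := by linarith
  have hsonic : 2 * (γ - 1) * E / (γ + 1) < 2 * E := by
    rw [div_lt_iff₀ hγ1]
    nlinarith
  obtain ⟨q, hKq, hq⟩ := exists_between hK1
  have hk : 0 < √K₀ := Real.sqrt_pos.2 hK0
  have hkb : √K₀ < √q := Real.sqrt_lt_sqrt hK0.le hKq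
  have hsq : ∀ t ∈ Set.Icc 0 √q, t ^ 2 < 2 * (γ - 1) * E / (γ + 1) := fun t ht => by
    refine lt_of_le_of_lt ?_ hq
    rw [← Real.sq_sqrt (hK0.trans hKq).le]
    exact pow_le_pow_left₀ ht.1 ht.2 2
  obtain ⟨Ψ, g, hg, hφ⟩ := exists_eq_radial (R := gasDensity γ A E)
    (R' := gasDensityDeriv γ A E) h0 h01 hk hkb hreg (fun x h1 h2 => heq x ⟨h1, h2⟩) hbc1
    (fun x hx => by rw [Real.sq_sqrt hK0.le]; exact hbc0 x hx)
    (fun t ht => hasDerivAt_gasDensity hγ hA ((hsq t ht).trans hsonic))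
    (fun t ht => gasDensity_pos hγ hA ((hsq t ht).trans hsonic))
    (fun t ht => gasDensity_add_deriv_pos hγ hA (hsq t ht) ((hsq t ht).trans hsonic))
  refine ⟨⟨Ψ, fun x hx => hφ x hx.1 hx.2⟩, fun x hx => ?_⟩
  have hlt : ∑ i, pdW {y | r₀ ≤ enorm3 y ∧ enorm3 y ≤ r₁} i φ x ^ 2 <
      2 * (γ - 1) * E / (γ + 1) := by
    rcases hx.1.eq_or_lt with h | h
    · rw [(hbc0 x h.symm).1]
      exact hK1
    · rw [sum_sq_pdW_radial h0 hφ h hx.2 (hg _ hx).1]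
      exact hsq _ (hg _ hx).2
  rw [lt_div_iff₀ hγ1] at hlt
  linarith
end

section
/- Let r₁>0, let V⊆ℝ³ be an open set containing the sphere S={x∈ℝ³ : |x|=r₁}, and let u:V→ℝ³ be continuously differentiable. Suppose that for every x∈S: (a) u(x)×x=0 (the velocity is purely radial on S), (b) u(x)·x≠0, and (c) u(x)×(∇×u)(x)=0. Then (∇×u)(x)=0 for every x∈S. -/
open scoped BigOperators

/-- Partial derivative `∂ⱼ f` at `x`. -/
noncomputable def pd (j : Fin 3) (f : (Fin 3 → ℝ) → ℝ) (x : Fin 3 → ℝ) : ℝ :=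
  fderiv ℝ f x (Pi.single j 1)

/-- The curl `∇×u` of a vector field. -/
noncomputable def curl3 (u : (Fin 3 → ℝ) → Fin 3 → ℝ) (x : Fin 3 → ℝ) : Fin 3 → ℝ :=
  ![pd 1 (fun y => u y 2) x - pd 2 (fun y => u y 1) x,
    pd 2 (fun y => u y 0) x - pd 0 (fun y => u y 2) x,
    pd 0 (fun y => u y 1) x - pd 1 (fun y => u y 0) x]

/-- Differentiating the identity `u × y = 0` along a curve on which it holds. -/
theorem fderiv_cross_add_cross_deriv_eq_zero {u : (Fin 3 → ℝ) → Fin 3 → ℝ}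
    {x v : Fin 3 → ℝ} {γ : ℝ → Fin 3 → ℝ} (hu : DifferentiableAt ℝ u x)
    (hγ : HasDerivAt γ v 0) (hx : γ 0 = x) (i j : Fin 3)
    (h : ∀ t, u (γ t) i * γ t j - u (γ t) j * γ t i = 0) :
    fderiv ℝ u x v i * x j - fderiv ℝ u x v j * x i + (u x i * v j - u x j * v i) = 0 := by
  subst hx
  have hc := hasDerivAt_pi.1 (hu.hasFDerivAt.comp_hasDerivAt (0 : ℝ) hγ)
  have hg := hasDerivAt_pi.1 hγ
  have hd := ((hc i).mul (hg j)).sub ((hc j).mul (hg i))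
  have h0 : HasDerivAt (fun _ : ℝ => (0 : ℝ)) 0 0 := hasDerivAt_const _ _
  have he := (hd.congr_of_eventuallyEq (f₁ := fun _ : ℝ => (0 : ℝ))
    (Filter.Eventually.of_forall fun t => (h t).symm)).unique h0
  simp only [Function.comp_apply] at he
  linarith

theorem fderiv_apply_eq_sum_pd {u : (Fin 3 → ℝ) → Fin 3 → ℝ} {x : Fin 3 → ℝ}
    (hu : DifferentiableAt ℝ u x) (v : Fin 3 → ℝ) (k : Fin 3) :
    fderiv ℝ u x v k = ∑ j, v j * pd j (fun y => u y k) x := by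
  have hk : ∀ w, fderiv ℝ (fun y => u y k) x w = fderiv ℝ u x w k := fun w => by
    rw [(hasFDerivAt_pi'.1 hu.hasFDerivAt k).fderiv]
    rfl
  simp only [pd]
  rw [← hk]
  conv_lhs => rw [pi_eq_sum_univ' v]
  simp [Pi.single]

/-- A `C¹` field that is radial on a sphere has no radial vorticity there. -/
theorem radial_curl_eq_zero {r : ℝ} (hr : 0 < r) {u : (Fin 3 → ℝ) → Fin 3 → ℝ}
    (hradial : ∀ x, enorm3 x = r →
      u x 1 * x 2 - u x 2 * x 1 = 0 ∧
      u x 2 * x 0 - u x 0 * x 2 = 0 ∧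
      u x 0 * x 1 - u x 1 * x 0 = 0)
    {x : Fin 3 → ℝ} (hx : enorm3 x = r) (hu : DifferentiableAt ℝ u x) :
    x 0 * curl3 u x 0 + x 1 * curl3 u x 1 + x 2 * curl3 u x 2 = 0 := by
  have hpos : 0 < x 0 ^ 2 + x 1 ^ 2 + x 2 ^ 2 := by
    have h : 0 < enorm3 x := hx ▸ hr
    simpa [enorm3, Fin.sum_univ_three] using h
  have hsphere : ∀ y : Fin 3 → ℝ,
      y 0 ^ 2 + y 1 ^ 2 + y 2 ^ 2 = x 0 ^ 2 + x 1 ^ 2 + x 2 ^ 2 → enorm3 y = r := by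
    intro y hy
    rw [← hx]
    simp only [enorm3, Fin.sum_univ_three, hy]
  have hrot : ∀ a b : ℝ,
      HasDerivAt (fun t => Real.cos t * a - Real.sin t * b) (-b) 0 ∧
      HasDerivAt (fun t => Real.sin t * a + Real.cos t * b) a 0 := fun a b => by
    constructor
    · simpa using! ((Real.hasDerivAt_cos 0).mul_const a).sub ((Real.hasDerivAt_sin 0).mul_const b)
    · simpa using! ((Real.hasDerivAt_sin 0).mul_const a).add ((Real.hasDerivAt_cos 0).mul_const b)
  have key : ∀ (γ : ℝ → Fin 3 → ℝ) (v : Fin 3 → ℝ), HasDerivAt γ v 0 → γ 0 = x →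
      (∀ t, γ t 0 ^ 2 + γ t 1 ^ 2 + γ t 2 ^ 2 = x 0 ^ 2 + x 1 ^ 2 + x 2 ^ 2) → _ :=
    fun γ v hγ h0 hs => And.intro
      (fderiv_cross_add_cross_deriv_eq_zero hu hγ h0 1 2
        fun t => (hradial _ (hsphere _ (hs t))).1) <| And.intro
      (fderiv_cross_add_cross_deriv_eq_zero hu hγ h0 2 0
        fun t => (hradial _ (hsphere _ (hs t))).2.1)
      (fderiv_cross_add_cross_deriv_eq_zero hu hγ h0 0 1
        fun t => (hradial _ (hsphere _ (hs t))).2.2)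
  obtain ⟨-, h01, h02⟩ := key
    (fun t => ![x 0, Real.cos t * x 1 - Real.sin t * x 2, Real.sin t * x 1 + Real.cos t * x 2])
    ![0, -x 2, x 1]
    (by
      rw [hasDerivAt_pi]
      intro i
      fin_cases i
      exacts [hasDerivAt_const _ _, (hrot _ _).1, (hrot _ _).2])
    (by ext i; fin_cases i <;> simp)
    (fun t => by
      simp only [Matrix.cons_val]
      linear_combination (x 1 ^ 2 + x 2 ^ 2) * Real.sin_sq_add_cos_sq t)
  obtain ⟨h10, -, h12⟩ := key
    (fun t => ![Real.sin t * x 2 + Real.cos t * x 0, x 1, Real.cos t * x 2 - Real.sin t * x 0])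
    ![x 2, 0, -x 0]
    (by
      rw [hasDerivAt_pi]
      intro i
      fin_cases i
      exacts [(hrot _ _).2, hasDerivAt_const _ _, (hrot _ _).1])
    (by ext i; fin_cases i <;> simp)
    (fun t => by
      simp only [Matrix.cons_val]
      linear_combination (x 2 ^ 2 + x 0 ^ 2) * Real.sin_sq_add_cos_sq t)
  obtain ⟨h20, h21, -⟩ := key
    (fun t => ![Real.cos t * x 0 - Real.sin t * x 1, Real.sin t * x 0 + Real.cos t * x 1, x 2])
    ![-x 1, x 0, 0]
    (by
      rw [hasDerivAt_pi]
      intro i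
      fin_cases i
      exacts [(hrot _ _).1, (hrot _ _).2, hasDerivAt_const _ _])
    (by ext i; fin_cases i <;> simp)
    (fun t => by
      simp only [Matrix.cons_val]
      linear_combination (x 0 ^ 2 + x 1 ^ 2) * Real.sin_sq_add_cos_sq t)
  simp only [fderiv_apply_eq_sum_pd hu, Fin.sum_univ_three, Matrix.cons_val] at h01 h02 h10 h12 h20 h21
  refine (mul_eq_zero.1 ?_).resolve_left hpos.ne'
  simp only [curl3, Matrix.cons_val]
  linear_combination (x 1 * h02 - x 2 * h01) + (x 2 * h10 - x 0 * h12) + (x 0 * h21 - x 1 * h20)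

/-- If on the sphere `|x| = r₁` the `C¹` velocity field is purely radial
(`u×x = 0`), non-degenerate (`u·x ≠ 0`), and satisfies `u×(∇×u) = 0`, then the
vorticity vanishes on the sphere. -/
theorem curl_vanishes_on_sphere
    (r₁ : ℝ) (hr : 0 < r₁)
    (V : Set (Fin 3 → ℝ)) (hV : IsOpen V)
    (hSV : {x : Fin 3 → ℝ | enorm3 x = r₁} ⊆ V)
    (u : (Fin 3 → ℝ) → Fin 3 → ℝ) (hu : ContDiffOn ℝ 1 u V)
    (hradial : ∀ x, enorm3 x = r₁ →
      u x 1 * x 2 - u x 2 * x 1 = 0 ∧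
      u x 2 * x 0 - u x 0 * x 2 = 0 ∧
      u x 0 * x 1 - u x 1 * x 0 = 0)
    (hne : ∀ x, enorm3 x = r₁ → (∑ i, u x i * x i) ≠ 0)
    (hcross : ∀ x, enorm3 x = r₁ →
      u x 1 * curl3 u x 2 - u x 2 * curl3 u x 1 = 0 ∧
      u x 2 * curl3 u x 0 - u x 0 * curl3 u x 2 = 0 ∧
      u x 0 * curl3 u x 1 - u x 1 * curl3 u x 0 = 0) :
    ∀ x, enorm3 x = r₁ → ∀ i, curl3 u x i = 0 := by
  intro x hx
  have hd : DifferentiableAt ℝ u x :=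
    (hu.differentiableOn one_ne_zero).differentiableAt (hV.mem_nhds (hSV hx))
  have hrad := radial_curl_eq_zero hr hradial hx hd
  have hn := hne x hx
  obtain ⟨h0, h1, h2⟩ := hcross x hx
  rw [Fin.sum_univ_three] at hn
  intro i
  refine (mul_eq_zero.1 ?_).resolve_left hn
  fin_cases i
  · simp only [Fin.zero_eta]
    linear_combination u x 0 * hrad - (x 1 * h2 - x 2 * h1)
  · simp only [Fin.mk_one]
    linear_combination u x 1 * hrad - (x 2 * h0 - x 0 * h2)
  · simp only [Fin.reduceFinMk]
    linear_combination u x 2 * hrad - (x 0 * h1 - x 1 * h0)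
end
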